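/- (τ-stationary points with integral data are δ-local minimizers.) Suppose all entries of A, b, c and λ are integers, λ ≥ 0, and ρ is a positive integer. Let δ > 0 and let x* ∈ X be a τ-stationary point with step size τ > δ/2. Then x* is a δ-local minimizer of min_{x∈X} L(x,λ,ρ): for every x ∈ X with ‖x − x*‖² ≤ δ, L(x,λ,ρ) ≥ L(x*,λ,ρ). -/

import Mathlib

open Matrix

/-- componentwise positive part -/
noncomputable def posv {k : ℕ} (v : Fin k → ℝ) : Fin k → ℝ := fun i => max (v i) 0

/-- The augmented Lagrangian
`L(x,λ,ρ) = cᵀx + λᵀ(Ax − b) + (ρ/2)‖(Ax − b)₊‖²`. -/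
noncomputable def aL {m n : ℕ} (A : Matrix (Fin m) (Fin n) ℝ) (b : Fin m → ℝ)
    (c : Fin n → ℝ) (x : Fin n → ℝ) (lam : Fin m → ℝ) (ρ : ℝ) : ℝ :=
  c ⬝ᵥ x + lam ⬝ᵥ (A.mulVec x - b) + (ρ / 2) * ∑ i, (posv (A.mulVec x - b)) i ^ 2

/-- The gradient in `x` of the augmented Lagrangian:
`∇L(x,λ,ρ) = c + Aᵀλ + ρ·Aᵀ(Ax − b)₊`. -/
noncomputable def gradL {m n : ℕ} (A : Matrix (Fin m) (Fin n) ℝ) (b : Fin m → ℝ)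
    (c : Fin n → ℝ) (lam : Fin m → ℝ) (ρ : ℝ) (x : Fin n → ℝ) : Fin n → ℝ :=
  fun j => c j + Aᵀ.mulVec lam j + ρ * Aᵀ.mulVec (posv (A.mulVec x - b)) j

lemma sq_posPart_tangent_le (u v : ℝ) :
    max u 0 ^ 2 + 2 * (max u 0 * (v - u)) ≤ max v 0 ^ 2 := by
  rcases max_cases u 0 with ⟨h, hu⟩ | ⟨h, hu⟩ <;> rcases max_cases v 0 with ⟨h', hv⟩ | ⟨h', hv⟩ <;>
    rw [h, h'] <;> nlinarith [sq_nonneg (u - v), sq_nonneg v]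

lemma gradL_dotProduct {m n : ℕ} (A : Matrix (Fin m) (Fin n) ℝ) (b : Fin m → ℝ)
    (c : Fin n → ℝ) (lam : Fin m → ℝ) (ρ : ℝ) (x d : Fin n → ℝ) :
    gradL A b c lam ρ x ⬝ᵥ d =
      c ⬝ᵥ d + lam ⬝ᵥ A.mulVec d + ρ * (posv (A.mulVec x - b) ⬝ᵥ A.mulVec d) := by
  have h : gradL A b c lam ρ x =
      c + Aᵀ.mulVec lam + ρ • Aᵀ.mulVec (posv (A.mulVec x - b)) := by
    ext j
    simp [gradL]
  rw [h, add_dotProduct, add_dotProduct, smul_dotProduct, mulVec_transpose, mulVec_transpose,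
    ← dotProduct_mulVec, ← dotProduct_mulVec, smul_eq_mul]

/-- The gradient inequality for the augmented Lagrangian, which is convex for `ρ ≥ 0`. -/
lemma aL_add_gradL_le {m n : ℕ} (A : Matrix (Fin m) (Fin n) ℝ) (b : Fin m → ℝ)
    (c : Fin n → ℝ) (lam : Fin m → ℝ) {ρ : ℝ} (hρ : 0 ≤ ρ) (x y : Fin n → ℝ) :
    aL A b c x lam ρ + gradL A b c lam ρ x ⬝ᵥ (y - x) ≤ aL A b c y lam ρ := by
  have h : ∑ i, posv (A.mulVec x - b) i ^ 2 + 2 * (posv (A.mulVec x - b) ⬝ᵥ A.mulVec (y - x)) ≤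
      ∑ i, posv (A.mulVec y - b) i ^ 2 := by
    rw [dotProduct, Finset.mul_sum, ← Finset.sum_add_distrib]
    refine Finset.sum_le_sum fun i _ => ?_
    have := sq_posPart_tangent_le ((A.mulVec x - b) i) ((A.mulVec y - b) i)
    simpa [posv, mulVec_sub] using this
  rw [gradL_dotProduct]
  simp only [aL, mulVec_sub, dotProduct_sub] at h ⊢
  nlinarith [mul_le_mul_of_nonneg_left h hρ]

lemma dotProduct_mem_subring {R : Type*} [CommRing R] (S : Subring R) {k : ℕ} {v w : Fin k → R}
    (hv : ∀ i, v i ∈ S) (hw : ∀ i, w i ∈ S) : v ⬝ᵥ w ∈ S :=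
  S.sum_mem fun i _ => S.mul_mem (hv i) (hw i)

lemma gradL_mem_subring {m n : ℕ} (S : Subring ℝ) {A : Matrix (Fin m) (Fin n) ℝ} {b : Fin m → ℝ}
    {c : Fin n → ℝ} {lam : Fin m → ℝ} {ρ : ℝ} {x : Fin n → ℝ} (hA : ∀ i j, A i j ∈ S)
    (hb : ∀ i, b i ∈ S) (hc : ∀ j, c j ∈ S) (hlam : ∀ i, lam i ∈ S) (hρ : ρ ∈ S)
    (hx : ∀ j, x j ∈ S) (j : Fin n) : gradL A b c lam ρ x j ∈ S := by
  have hpos : ∀ i, posv (A.mulVec x - b) i ∈ S := fun i => by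
    have hi : (A.mulVec x - b) i ∈ S := S.sub_mem (dotProduct_mem_subring S (hA i) hx) (hb i)
    rcases max_choice ((A.mulVec x - b) i) 0 with h | h
    · simpa only [posv, h] using hi
    · simpa only [posv, h] using S.zero_mem
  exact S.add_mem (S.add_mem (hc j) (dotProduct_mem_subring S (fun i => hA i j) hlam))
    (S.mul_mem hρ (dotProduct_mem_subring S (fun i => hA i j) hpos))

/-- On binary vectors the linear term `(1/2 - x)ᵀ(y - x)` is half the squared distance. -/
lemma stationarity_form_sub {n : ℕ} (τ : ℝ) (g : Fin n → ℝ) {x y : Fin n → ℝ}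
    (hx : ∀ i, x i = 0 ∨ x i = 1) (hy : ∀ i, y i = 0 ∨ y i = 1) :
    (fun j => τ * g j + 1 / 2 - x j) ⬝ᵥ y - (fun j => τ * g j + 1 / 2 - x j) ⬝ᵥ x =
      τ * (g ⬝ᵥ (y - x)) + (∑ j, (y j - x j) ^ 2) / 2 := by
  rw [← dotProduct_sub]
  simp only [dotProduct, Finset.mul_sum, Finset.sum_div, ← Finset.sum_add_distrib, Pi.sub_apply]
  refine Finset.sum_congr rfl fun j _ => ?_
  rcases hx j with h | h <;> rcases hy j with h' | h' <;> rw [h, h'] <;> ring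

/-- τ-stationary points with integral data are δ-local minimizers.
If all entries of `A, b, c, λ` are integers, `λ ≥ 0`, `ρ` is a positive integer,
`δ > 0` and `x* ∈ X` is a `τ`-stationary point with `τ > δ/2`, then `x*` is a `δ`-local
minimizer: `L(x,λ,ρ) ≥ L(x*,λ,ρ)` for all `x ∈ X` with `‖x − x*‖² ≤ δ`. -/
theorem tau_stationary_is_delta_local_min {m n : ℕ} (A : Matrix (Fin m) (Fin n) ℝ)
    (b : Fin m → ℝ) (c : Fin n → ℝ) (X : Set (Fin n → ℝ))
    (hXfin : X.Finite) (hXne : X.Nonempty)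
    (hXbin : ∀ x ∈ X, ∀ i, x i = 0 ∨ x i = 1)
    (hA : ∀ i j, ∃ z : ℤ, A i j = (z : ℝ)) (hb : ∀ i, ∃ z : ℤ, b i = (z : ℝ))
    (hc : ∀ j, ∃ z : ℤ, c j = (z : ℝ))
    (lam : Fin m → ℝ) (hlamInt : ∀ i, ∃ z : ℤ, lam i = (z : ℝ))
    (hlam : ∀ i, 0 ≤ lam i)
    (ρ : ℝ) (hρInt : ∃ k : ℕ, 0 < k ∧ ρ = (k : ℝ))
    (δ : ℝ) (hδ : 0 < δ)
    (τ : ℝ) (hτ : δ / 2 < τ)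
    (xstar : Fin n → ℝ) (hxstarX : xstar ∈ X)
    (hstat : ∀ x ∈ X,
      (fun j => τ * gradL A b c lam ρ xstar j + 1 / 2 - xstar j) ⬝ᵥ xstar
        ≤ (fun j => τ * gradL A b c lam ρ xstar j + 1 / 2 - xstar j) ⬝ᵥ x) :
    ∀ x ∈ X, (∑ j, (x j - xstar j) ^ 2) ≤ δ →
      aL A b c xstar lam ρ ≤ aL A b c x lam ρ := by
  intro x hx hdist
  obtain ⟨k, -, rfl⟩ := hρInt
  let S : Subring ℝ := (Int.castRingHom ℝ).range
  have mem_S : ∀ r : ℝ, (∃ z : ℤ, r = z) → r ∈ S := fun r ⟨z, hz⟩ => ⟨z, by simp [hz]⟩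
  have hX_S : ∀ y ∈ X, ∀ j, y j ∈ S := fun y hy j => by
    rcases hXbin y hy j with h | h <;> rw [h]
    exacts [S.zero_mem, S.one_mem]
  have hint : gradL A b c lam k xstar ⬝ᵥ (x - xstar) ∈ S :=
    dotProduct_mem_subring S
      (gradL_mem_subring S (fun i j => mem_S _ (hA i j)) (fun i => mem_S _ (hb i))
        (fun j => mem_S _ (hc j)) (fun i => mem_S _ (hlamInt i)) (natCast_mem S k)
        (hX_S xstar hxstarX))
      fun j => S.sub_mem (hX_S x hx j) (hX_S xstar hxstarX j)
  obtain ⟨z, hz⟩ := hint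
  rw [eq_intCast] at hz
  have hform := stationarity_form_sub τ (gradL A b c lam k xstar)
    (hXbin xstar hxstarX) (hXbin x hx)
  have hgt : (-1 : ℝ) < z := by
    rw [hz]
    nlinarith [hstat x hx]
  have hz_nonneg : (0 : ℝ) ≤ z := by
    have : (-1 : ℤ) < z := by exact_mod_cast hgt
    exact_mod_cast (show (0 : ℤ) ≤ z by lia)
  linarith [aL_add_gradL_le A b c lam k.cast_nonneg xstar x]
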